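/- Let S be an irreducible constraint, presented by an irreducible deterministic labeled graph G over an alphabet Σ, and let Σ0 and Σ1 be (not necessarily disjoint) nonempty subsets of Σ with Σ0 ∪ Σ1 = Σ. Let n0 and n1 be positive integers. If there exists a lossless graph E with S(E) ⊆ S such that, for each b ∈ {0,1}, every state of E has exactly n_b outgoing edges with labels in Σ_b, then there exists a nonnegative nonzero integer vector x indexed by the states of G satisfying componentwise A_{G_0} x ≥ n0 x and A_{G_1} x ≥ n1 x, where G_b denotes the subgraph of G of edges with labels in Σ_b (so G_0 and G_1 may share edges). -/

import Mathlib

open scoped Classical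

/-- A finite labeled directed graph over alphabet `A`: a nonempty finite set of
states, a finite set of edges each with an initial and terminal state, and a
labeling of edges by symbols of `A`. -/
structure LGraph (A : Type u) where
  V : Type u
  [fintypeV : Fintype V]
  [nonemptyV : Nonempty V]
  E : Type u
  [fintypeE : Fintype E]
  src : E → V
  dst : E → V
  lab : E → A

attribute [instance] LGraph.fintypeV LGraph.nonemptyV LGraph.fintypeE

namespace LGraph

variable {A : Type*}

/-- `G.IsWalk u es` : `es` is a sequence of consecutive edges starting at `u`. -/
def IsWalk (G : LGraph A) : G.V → List G.E → Prop
  | _, [] => True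
  | u, e :: es => G.src e = u ∧ G.IsWalk (G.dst e) es

/-- The terminal state of a walk. -/
def endState (G : LGraph A) : G.V → List G.E → G.V
  | u, [] => u
  | _, e :: es => G.endState (G.dst e) es

/-- The constraint `S(G)` presented by `G`: all words generated by finite paths. -/
def constraint (G : LGraph A) : Set (List A) :=
  { w | ∃ u es, G.IsWalk u es ∧ es.map G.lab = w }

/-- No state has two distinct outgoing edges with the same label. -/
def Deterministic (G : LGraph A) : Prop :=
  ∀ e e' : G.E, G.src e = G.src e' → G.lab e = G.lab e' → e = e'

/-- No two distinct paths with the same initial state and the same terminal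
state generate the same word. -/
def Lossless (G : LGraph A) : Prop :=
  ∀ (u : G.V) (es es' : List G.E), G.IsWalk u es → G.IsWalk u es' →
    G.endState u es = G.endState u es' → es.map G.lab = es'.map G.lab → es = es'

/-- Strong connectivity. -/
def Irreducible (G : LGraph A) : Prop :=
  ∀ u v : G.V, ∃ es : List G.E, G.IsWalk u es ∧ G.endState u es = v

/-- Primitivity (in the equivalent form: some power of the adjacency matrix is
entrywise positive, i.e. there is a uniform positive length `ℓ` such that any
state can be reached from any state by a walk of length `ℓ`). -/
def Primitive (G : LGraph A) : Prop :=
  ∃ ℓ : ℕ, 0 < ℓ ∧ ∀ u v : G.V, ∃ es : List G.E,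
    G.IsWalk u es ∧ es.length = ℓ ∧ G.endState u es = v

/-- The adjacency matrix of the subgraph of `G` consisting of the edges whose
labels lie in `P`: its `(u,v)` entry is the number of edges from `u` to `v`
with label in `P`. -/
noncomputable def subAdj (G : LGraph A) (P : Set A) : G.V → G.V → ℕ :=
  fun u v => Nat.card {e : G.E // G.src e = u ∧ G.dst e = v ∧ G.lab e ∈ P}

/-- Every state has exactly `n` outgoing edges with label in `P`. -/
def OutDeg (G : LGraph A) (P : Set A) (n : ℕ) : Prop :=
  ∀ u : G.V, Nat.card {e : G.E // G.src e = u ∧ G.lab e ∈ P} = n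

/-- An `(S, n0, n1)`-encoder with respect to the even/odd symbol sets `S0, S1`:
a lossless graph whose constraint is contained in `S` and in which every state
has exactly `n0` outgoing edges with even labels and exactly `n1` outgoing
edges with odd labels. -/
def IsEncoder (En : LGraph A) (S : Set (List A)) (S0 S1 : Set A) (n0 n1 : ℕ) : Prop :=
  En.Lossless ∧ En.constraint ⊆ S ∧ En.OutDeg S0 n0 ∧ En.OutDeg S1 n1

/-- `x ∈ X(A_{G_0}, A_{G_1}, n0, n1)`: a nonnegative nonzero integer vector with
`A_{G_0} x ≥ n0 x` and `A_{G_1} x ≥ n1 x` componentwise. -/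
def InX (G : LGraph A) (S0 S1 : Set A) (n0 n1 : ℕ) (x : G.V → ℕ) : Prop :=
  x ≠ 0 ∧ (∀ u, n0 * x u ≤ ∑ v, G.subAdj S0 u v * x v)
        ∧ (∀ u, n1 * x u ≤ ∑ v, G.subAdj S1 u v * x v)

/-- The graph has anticipation at most `a`: all paths from a common state that
generate the same word of length `a+1` share the same first edge. -/
def AnticipationAtMost (G : LGraph A) (a : ℕ) : Prop :=
  ∀ (u : G.V) (es es' : List G.E), G.IsWalk u es → G.IsWalk u es' →
    es.length = a + 1 → es'.length = a + 1 → es.map G.lab = es'.map G.lab →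
    es.head? = es'.head?

/-- The graph has memory at most `μ`: all paths of length `μ` generating the
same word terminate in the same state. -/
def MemoryAtMost (G : LGraph A) (μ : ℕ) : Prop :=
  ∀ (u u' : G.V) (es es' : List G.E), G.IsWalk u es → G.IsWalk u' es' →
    es.length = μ → es'.length = μ → es.map G.lab = es'.map G.lab →
    G.endState u es = G.endState u' es'

/-- `(m,a)`-definiteness: all paths generating a given word of length `m+a+1`
share the same `(m+1)`-st edge. -/
def Definite (G : LGraph A) (m a : ℕ) : Prop :=
  ∀ (u u' : G.V) (es es' : List G.E), G.IsWalk u es → G.IsWalk u' es' →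
    es.length = m + a + 1 → es'.length = m + a + 1 → es.map G.lab = es'.map G.lab →
    es[m]? = es'[m]?

end LGraph

namespace LGraph

variable {A : Type*}

theorem isWalk_append (G : LGraph A) (u : G.V) (es fs : List G.E) :
    G.IsWalk u (es ++ fs) ↔ G.IsWalk u es ∧ G.IsWalk (G.endState u es) fs := by
  induction es generalizing u with
  | nil => simp [IsWalk, endState]
  | cons e es ih => simp [IsWalk, endState, ih, and_assoc]

theorem endState_append (G : LGraph A) (u : G.V) (es fs : List G.E) :
    G.endState u (es ++ fs) = G.endState (G.endState u es) fs := by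
  induction es generalizing u with
  | nil => rfl
  | cons e es ih => simp [endState, ih]

/-- In a deterministic graph a walk is determined by its initial state and its word. -/
theorem Deterministic.walk_unique {G : LGraph A} (hG : G.Deterministic) {u : G.V}
    {es fs : List G.E} (hes : G.IsWalk u es) (hfs : G.IsWalk u fs)
    (h : es.map G.lab = fs.map G.lab) : es = fs := by
  induction es generalizing u fs with
  | nil => simpa [eq_comm] using h
  | cons e es ih =>
    cases fs with
    | nil => simp at h
    | cons f fs =>
      simp only [List.map_cons, List.cons.injEq] at h
      obtain rfl : e = f := hG e f (hes.1.trans hfs.1.symm) h.1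
      rw [ih hes.2 hfs.2 h.2]

/-- There is a walk from `u` to `z` generating the word `w`. -/
def Reaches (G : LGraph A) (u : G.V) (w : List A) (z : G.V) : Prop :=
  ∃ es, G.IsWalk u es ∧ es.map G.lab = w ∧ G.endState u es = z

theorem reaches_append {G : LGraph A} {u z : G.V} {w w' : List A} :
    G.Reaches u (w ++ w') z ↔ ∃ y, G.Reaches u w y ∧ G.Reaches y w' z := by
  constructor
  · rintro ⟨es, hes, hw, rfl⟩
    obtain ⟨es, fs, rfl, rfl, rfl⟩ := List.map_eq_append_iff.1 hw
    rw [isWalk_append] at hes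
    exact ⟨_, ⟨es, hes.1, rfl, rfl⟩, fs, hes.2, rfl, (G.endState_append u es fs).symm⟩
  · rintro ⟨y, ⟨es, hes, rfl, rfl⟩, fs, hfs, rfl, rfl⟩
    exact ⟨es ++ fs, (G.isWalk_append u es fs).2 ⟨hes, hfs⟩, List.map_append,
      G.endState_append u es fs⟩

theorem reaches_singleton {G : LGraph A} {u z : G.V} {a : A} :
    G.Reaches u [a] z ↔ ∃ e, G.src e = u ∧ G.lab e = a ∧ G.dst e = z := by
  constructor
  · rintro ⟨es, hes, hw, rfl⟩
    obtain ⟨e, rfl, rfl⟩ := List.map_eq_singleton_iff.1 hw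
    exact ⟨e, hes.1, rfl, rfl⟩
  · rintro ⟨e, rfl, rfl, rfl⟩
    exact ⟨[e], ⟨rfl, trivial⟩, rfl, rfl⟩

theorem Deterministic.reaches_unique {G : LGraph A} (hG : G.Deterministic) {u z z' : G.V}
    {w : List A} (h : G.Reaches u w z) (h' : G.Reaches u w z') : z = z' := by
  obtain ⟨es, hes, rfl, rfl⟩ := h
  obtain ⟨fs, hfs, hw, rfl⟩ := h'
  rw [hG.walk_unique hes hfs hw.symm]

/-- If a deterministic graph `G` presents every word of `H`, then some state of `G` has a
follower set containing the follower set of some state of `H`. -/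
theorem Deterministic.exists_follower_subset {G H : LGraph A} (hG : G.Deterministic)
    (hsub : H.constraint ⊆ G.constraint) :
    ∃ (u : H.V) (v : G.V), ∀ w z, H.Reaches u w z → ∃ y, G.Reaches v w y := by
  let T : List A → Finset G.V := fun w => Finset.univ.filter fun z => ∃ v, G.Reaches v w z
  let p : {p : List A × H.V // ∃ u, H.Reaches u p.1 p.2} :=
    ⟨([], Classical.arbitrary H.V), Classical.arbitrary H.V, [], trivial, rfl, rfl⟩
  have : Nonempty {p : List A × H.V // ∃ u, H.Reaches u p.1 p.2} := ⟨p⟩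
  obtain ⟨⟨⟨w, u⟩, u₀, hu⟩, hmin⟩ :=
    exists_minimalFor_of_wellFoundedLT
      (fun _ : {p : List A × H.V // ∃ u, H.Reaches u p.1 p.2} => True)
      (fun p => (T p.1.1).card) ⟨p, trivial⟩
  have hTw : (T w).Nonempty := by
    obtain ⟨es, hes, hw, -⟩ := hu
    obtain ⟨v, gs, hgs, hgw⟩ := hsub ⟨u₀, es, hes, hw⟩
    exact ⟨_, Finset.mem_filter.2 ⟨Finset.mem_univ _, v, gs, hgs, hgw, rfl⟩⟩
  obtain ⟨v, hv⟩ := hTw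
  refine ⟨u, v, fun w' z hz => ?_⟩
  have hmid : ∀ y ∈ T (w ++ w'), ∃ m ∈ T w, G.Reaches m w' y := by
    intro y hy
    obtain ⟨-, s, hs⟩ := Finset.mem_filter.1 hy
    obtain ⟨m, hm, hmy⟩ := reaches_append.1 hs
    exact ⟨m, Finset.mem_filter.2 ⟨Finset.mem_univ _, s, hm⟩, hmy⟩
  choose! f hfT hf using hmid
  have hinj : Set.InjOn f (T (w ++ w')) := fun y hy y' hy' h =>
    hG.reaches_unique (hf y hy) (h ▸ hf y' hy')
  have hle : (T w).card ≤ (T (w ++ w')).card := by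
    have hall := minimalFor_iff_forall_lt.1 hmin
    by_contra hlt
    exact hall.2 (j := ⟨(w ++ w', z), u₀, reaches_append.2 ⟨u, hu, hz⟩⟩) (not_le.1 hlt) trivial
  obtain ⟨y, hy, rfl⟩ := Finset.surj_on_of_inj_on_of_card_le (fun y _ => f y) hfT
    (fun y y' hy hy' h => hinj hy hy' h) hle v hv
  exact ⟨y, hf y hy⟩

theorem sum_subAdj_mul (G : LGraph A) (P : Set A) (x : G.V → ℕ) (u : G.V) :
    ∑ v, G.subAdj P u v * x v =
      ∑ e ∈ Finset.univ.filter (fun e => G.src e = u ∧ G.lab e ∈ P), x (G.dst e) := by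
  rw [← Finset.sum_fiberwise _ G.dst]
  refine Finset.sum_congr rfl fun v _ => ?_
  rw [Finset.sum_congr rfl (g := fun _ => x v) (by simp +contextual), Finset.sum_const,
    smul_eq_mul, Finset.filter_filter, subAdj, Nat.card_eq_fintype_card, Fintype.card_subtype]
  congr 3
  ext e
  simp only [and_left_comm, and_comm]

/-- The set of states reachable from `u` by walks generating the word `w`. -/
noncomputable def reachSet (G : LGraph A) (u : G.V) (w : List A) : Finset G.V :=
  Finset.univ.filter (G.Reaches u w)

theorem mem_reachSet {G : LGraph A} {u z : G.V} {w : List A} :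
    z ∈ G.reachSet u w ↔ G.Reaches u w z := by
  simp [reachSet]

/-- In a lossless graph, an edge leaving a state reached from `u` by `w` is determined by its
label and its terminal state. -/
theorem Lossless.edge_unique {H : LGraph A} (hH : H.Lossless) {u : H.V} {w : List A}
    {e f : H.E} (he : H.Reaches u w (H.src e)) (hf : H.Reaches u w (H.src f))
    (hlab : H.lab e = H.lab f) (hdst : H.dst e = H.dst f) : e = f := by
  obtain ⟨es, hes, hw, hend⟩ := he
  obtain ⟨fs, hfs, hw', hend'⟩ := hf
  have := hH u (es ++ [e]) (fs ++ [f])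
    ((H.isWalk_append _ _ _).2 ⟨hes, hend.symm, trivial⟩)
    ((H.isWalk_append _ _ _).2 ⟨hfs, hend'.symm, trivial⟩)
    (by simpa [endState_append, endState] using hdst) (by simp [hw, hw', hlab])
  simpa using (List.append_inj' this rfl).2

/-- The number of edges leaving `H.reachSet u w` with label in `P` is bounded by the sizes of the
successor sets along the edges leaving `v` in `G`. -/
theorem Lossless.mul_card_reachSet_le {G H : LGraph A} (hH : H.Lossless) {P : Set A} {n : ℕ}
    (hdeg : H.OutDeg P n) {u : H.V} {v : G.V} {w : List A}
    (hv : ∀ a z, H.Reaches u (w ++ [a]) z → ∃ g, G.src g = v ∧ G.lab g = a) :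
    n * (H.reachSet u w).card ≤
      ∑ g ∈ Finset.univ.filter (fun g => G.src g = v ∧ G.lab g ∈ P),
        (H.reachSet u (w ++ [G.lab g])).card := by
  let D := Finset.univ.filter fun e => H.src e ∈ H.reachSet u w ∧ H.lab e ∈ P
  have hstep : ∀ e ∈ D, H.Reaches u (w ++ [H.lab e]) (H.dst e) := fun e he =>
    reaches_append.2 ⟨_, mem_reachSet.1 (Finset.mem_filter.1 he).2.1,
      reaches_singleton.2 ⟨e, rfl, rfl, rfl⟩⟩
  have hD : D.card = n * (H.reachSet u w).card := by
    rw [Finset.card_eq_sum_card_fiberwise (f := H.src) (t := H.reachSet u w)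
      (fun e he => (Finset.mem_filter.1 he).2.1), mul_comm, ← smul_eq_mul, ← Finset.sum_const]
    refine Finset.sum_congr rfl fun z hz => ?_
    rw [← hdeg z, Nat.card_eq_fintype_card, Fintype.card_subtype, Finset.filter_filter]
    congr 1
    ext e
    simp only [Finset.mem_filter, Finset.mem_univ, true_and]
    constructor
    · rintro ⟨⟨-, h⟩, rfl⟩
      exact ⟨rfl, h⟩
    · rintro ⟨rfl, h⟩
      exact ⟨⟨hz, h⟩, rfl⟩
  have hg : ∀ e ∈ D, ∃ g, G.src g = v ∧ G.lab g = H.lab e := fun e he => hv _ _ (hstep e he)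
  rw [← hD]
  rcases D.eq_empty_or_nonempty with hempty | ⟨e₀, he₀⟩
  · simp [hempty]
  have : Nonempty G.E := (hg e₀ he₀).nonempty
  choose! f hfsrc hflab using hg
  rw [Finset.card_eq_sum_card_fiberwise (f := f)
    (t := Finset.univ.filter fun g => G.src g = v ∧ G.lab g ∈ P) (fun e he => by
      simpa [hfsrc e (Finset.mem_coe.1 he), hflab e (Finset.mem_coe.1 he)]
        using (Finset.mem_filter.1 he).2.2)]
  refine Finset.sum_le_sum fun g _ => Finset.card_le_card_of_injOn H.dst ?_ ?_
  · intro e he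
    obtain ⟨heD, rfl⟩ := Finset.mem_filter.1 he
    rw [hflab e heD]
    exact mem_reachSet.2 (hstep e heD)
  · intro e he e' he' hdst
    obtain ⟨heD, rfl⟩ := Finset.mem_filter.1 he
    obtain ⟨heD', hf⟩ := Finset.mem_filter.1 he'
    exact hH.edge_unique (mem_reachSet.1 (Finset.mem_filter.1 heD).2.1)
      (mem_reachSet.1 (Finset.mem_filter.1 heD').2.1)
      (by rw [← hflab e heD, ← hflab e' heD', hf]) hdst

/-- The largest size of `H.reachSet u w` over the words `w` leading from `v₀` to `v` in `G`. -/
noncomputable def maxReach (G H : LGraph A) (u : H.V) (v₀ v : G.V) : ℕ :=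
  (Finset.univ.filter fun Z => ∃ w, G.Reaches v₀ w v ∧ H.reachSet u w = Z).sup Finset.card

theorem card_reachSet_le_maxReach {G H : LGraph A} {u : H.V} {v₀ v : G.V} {w : List A}
    (h : G.Reaches v₀ w v) : (H.reachSet u w).card ≤ maxReach G H u v₀ v :=
  Finset.le_sup (f := Finset.card) (Finset.mem_filter.2 ⟨Finset.mem_univ _, w, h, rfl⟩)

theorem mul_maxReach_le {G H : LGraph A} (hG : G.Deterministic) (hH : H.Lossless) {P : Set A}
    {n : ℕ} (hdeg : H.OutDeg P n) {u : H.V} {v₀ : G.V}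
    (hfol : ∀ w z, H.Reaches u w z → ∃ y, G.Reaches v₀ w y) (v : G.V) :
    n * maxReach G H u v₀ v ≤ ∑ v', G.subAdj P v v' * maxReach G H u v₀ v' := by
  rcases (Finset.univ.filter fun Z =>
      ∃ w, G.Reaches v₀ w v ∧ H.reachSet u w = Z).eq_empty_or_nonempty with hempty | hne
  · simp [maxReach, hempty]
  obtain ⟨Z, hZ, hmax⟩ := Finset.exists_mem_eq_sup _ hne Finset.card
  obtain ⟨-, w, hw, rfl⟩ := Finset.mem_filter.1 hZ
  rw [sum_subAdj_mul, show maxReach G H u v₀ v = _ from hmax]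
  refine (hH.mul_card_reachSet_le hdeg (G := G) (v := v) ?_).trans
    (Finset.sum_le_sum fun g hg => card_reachSet_le_maxReach (reaches_append.2 ⟨v, hw,
      reaches_singleton.2 ⟨g, (Finset.mem_filter.1 hg).2.1, rfl, rfl⟩⟩))
  intro a z hz
  obtain ⟨y, hy⟩ := hfol _ _ hz
  obtain ⟨m, hm, hmy⟩ := reaches_append.1 hy
  obtain ⟨g, hgs, hgl, -⟩ := reaches_singleton.1 hmy
  exact ⟨g, hgs.trans (hG.reaches_unique hm hw), hgl⟩

end LGraph

/-- The necessary condition of Statement 1 for the more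
general setting in which the even and odd symbol sets `S0, S1` form a
(not necessarily disjoint) cover of the alphabet. -/
theorem bimodal_encoder_necessary_cover {A : Type*} (G : LGraph A) (S0 S1 : Set A)
    (hS0 : S0.Nonempty) (hS1 : S1.Nonempty)
    (hcover : S0 ∪ S1 = Set.univ)
    (hdet : G.Deterministic) (hirr : G.Irreducible)
    (n0 n1 : ℕ) (hn0 : 0 < n0) (hn1 : 0 < n1)
    (En : LGraph A) (hEn : LGraph.IsEncoder En G.constraint S0 S1 n0 n1) :
    ∃ x : G.V → ℕ, G.InX S0 S1 n0 n1 x := by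
  obtain ⟨hlossless, hsub, hdeg0, hdeg1⟩ := hEn
  obtain ⟨u, v₀, hfol⟩ := hdet.exists_follower_subset hsub
  refine ⟨LGraph.maxReach G En u v₀, fun h0 => ?_,
    LGraph.mul_maxReach_le hdet hlossless hdeg0 hfol,
    LGraph.mul_maxReach_le hdet hlossless hdeg1 hfol⟩
  have hpos : 0 < (En.reachSet u []).card :=
    Finset.card_pos.2 ⟨u, LGraph.mem_reachSet.2 ⟨[], trivial, rfl, rfl⟩⟩
  have hle := LGraph.card_reachSet_le_maxReach (H := En) (u := u) (v₀ := v₀) (v := v₀) (w := [])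
    ⟨[], trivial, rfl, rfl⟩
  rw [h0, Pi.zero_apply] at hle
  omega
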